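/- Let m>1 and 0<p<1 be reals with m+p<2 and let N≥1 be an integer. Then for every c∈ℝ there is no traveling-wave profile with speed c and interface. -/

import Mathlib

open Real Set Filter Topology

noncomputable section

/-- The convection coefficient `A = (N(m-1)+2(m+1))/(m-1)`. -/
def coefA (m : ℝ) (N : ℕ) : ℝ := ((N : ℝ) * (m - 1) + 2 * (m + 1)) / (m - 1)

/-- The reaction coefficient `B = 2m(N(m-1)+2)/(m-1)²`. -/
def coefB (m : ℝ) (N : ℕ) : ℝ := 2 * m * ((N : ℝ) * (m - 1) + 2) / (m - 1) ^ 2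

/-- A traveling-wave profile with speed `c` and interface at `y₀` for the
reaction-convection-diffusion equation `w_τ = (w^m)_{yy} + A (w^m)_y + B w^m + w^p`:
a nonnegative continuous profile, positive to the left of `y₀`, vanishing to the right,
solving `c f' = (f^m)'' + A (f^m)' + B f^m + f^p` on `(-∞, y₀)`, with
`(f^m)'(y) → 0` as `y → y₀⁻`. -/
structure TWProfile (m p c A B : ℝ) (f : ℝ → ℝ) (y₀ : ℝ) : Prop where
  cont : Continuous f
  nonneg : ∀ y, 0 ≤ f y
  pos : ∀ y < y₀, 0 < f y
  vanish : ∀ y, y₀ ≤ y → f y = 0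
  smooth : ContDiffOn ℝ 2 f (Iio y₀)
  ode : ∀ y < y₀, c * deriv f y =
    deriv (deriv (fun x => f x ^ m)) y + A * deriv (fun x => f x ^ m) y
      + B * f y ^ m + f y ^ p
  interface : Tendsto (fun y => deriv (fun x => f x ^ m) y) (𝓝[<] y₀) (𝓝 0)

/-- A function with nonnegative derivative on `(a, b)` and left limit `0` at `b` is nonpositive. -/
lemma nonpos_of_deriv_nonneg_of_tendsto_zero {g g' : ℝ → ℝ} {a b : ℝ}
    (hg : ∀ y ∈ Ioo a b, HasDerivAt g (g' y) y) (hg' : ∀ y ∈ Ioo a b, 0 ≤ g' y)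
    (hlim : Tendsto g (𝓝[<] b) (𝓝 0)) : ∀ y ∈ Ioo a b, g y ≤ 0 := by
  have hmono : MonotoneOn g (Ioo a b) := by
    refine monotoneOn_of_deriv_nonneg (convex_Ioo a b)
      (fun y hy => (hg y hy).continuousAt.continuousWithinAt)
      (fun y hy => ?_) (fun y hy => ?_)
    · rw [interior_Ioo] at hy
      exact (hg y hy).differentiableAt.differentiableWithinAt
    · rw [interior_Ioo] at hy
      rw [(hg y hy).deriv]
      exact hg' y hy
  intro y hy
  refine ge_of_tendsto hlim ?_
  filter_upwards [Ioo_mem_nhdsLT hy.2] with z hz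
  exact hmono hy ⟨hy.1.trans hz.1, hz.2⟩ hz.1.le

namespace TWProfile

variable {m p c A B : ℝ} {f : ℝ → ℝ} {y₀ : ℝ}

lemma tendsto_zero (h : TWProfile m p c A B f y₀) : Tendsto f (𝓝[<] y₀) (𝓝 0) := by
  have := (h.cont.tendsto y₀).mono_left (nhdsWithin_le_nhds (s := Iio y₀))
  rwa [h.vanish y₀ le_rfl] at this

lemma tendsto_rpow_zero (h : TWProfile m p c A B f y₀) {q : ℝ} (hq : 0 < q) :
    Tendsto (fun y => f y ^ q) (𝓝[<] y₀) (𝓝 0) := by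
  have := h.tendsto_zero.rpow_const (p := q) (Or.inr hq.le)
  rwa [Real.zero_rpow hq.ne'] at this

lemma hasDerivAt (h : TWProfile m p c A B f y₀) {y : ℝ} (hy : y < y₀) :
    HasDerivAt f (deriv f y) y :=
  ((h.smooth.contDiffAt (Iio_mem_nhds hy)).differentiableAt (by norm_num)).hasDerivAt

lemma hasDerivAt_rpow (h : TWProfile m p c A B f y₀) (q : ℝ) {y : ℝ} (hy : y < y₀) :
    HasDerivAt (fun x => f x ^ q) (deriv f y * q * f y ^ (q - 1)) y :=
  (h.hasDerivAt hy).rpow_const (Or.inl (h.pos y hy).ne')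

lemma hasDerivAt_deriv_rpow (h : TWProfile m p c A B f y₀) {y : ℝ} (hy : y < y₀) :
    HasDerivAt (deriv fun x => f x ^ m) (deriv (deriv fun x => f x ^ m) y) y := by
  have hv : ContDiffOn ℝ 2 (fun x => f x ^ m) (Iio y₀) :=
    h.smooth.rpow_const_of_ne fun x hx => (h.pos x hx).ne'
  have hv' : ContDiffOn ℝ 1 (deriv fun x => f x ^ m) (Iio y₀) :=
    hv.deriv_of_isOpen isOpen_Iio (by norm_num)
  exact ((hv'.contDiffAt (Iio_mem_nhds hy)).differentiableAt (by norm_num)).hasDerivAt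

/-- The flux `(f^m)' + A f^m - c f`, whose derivative is minus the reaction. -/
def flux (m c A : ℝ) (f : ℝ → ℝ) (y : ℝ) : ℝ :=
  deriv (fun x => f x ^ m) y + A * f y ^ m - c * f y

lemma hasDerivAt_flux (h : TWProfile m p c A B f y₀) {y : ℝ} (hy : y < y₀) :
    HasDerivAt (flux m c A f) (-(B * f y ^ m + f y ^ p)) y := by
  have hv := (h.hasDerivAt_rpow m hy).differentiableAt.hasDerivAt
  have := ((h.hasDerivAt_deriv_rpow hy).add (hv.const_mul A)).sub ((h.hasDerivAt hy).const_mul c)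
  refine this.congr_deriv ?_
  linarith [h.ode y hy]

lemma tendsto_flux (h : TWProfile m p c A B f y₀) (hm : 0 < m) :
    Tendsto (flux m c A f) (𝓝[<] y₀) (𝓝 0) := by
  unfold flux
  simpa using
    (h.interface.add ((h.tendsto_rpow_zero hm).const_mul A)).sub (h.tendsto_zero.const_mul c)

lemma flux_nonneg (h : TWProfile m p c A B f y₀) (hm : 0 < m) (hB : 0 ≤ B) {y : ℝ}
    (hy : y < y₀) : 0 ≤ flux m c A f y := by
  have key := nonpos_of_deriv_nonneg_of_tendsto_zero (a := y - 1) (b := y₀)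
    (g := fun x => -flux m c A f x) (fun x hx => (h.hasDerivAt_flux hx.2).neg)
    (fun x hx => ?_) (by simpa using (h.tendsto_flux hm).neg) y ⟨by linarith, hy⟩
  · simpa using key
  · have h1 := Real.rpow_nonneg (h.nonneg x) m
    have h2 := Real.rpow_nonneg (h.nonneg x) p
    rw [neg_neg]
    positivity

/-- Where `f ≤ 1`, the diffusive flux `(f^m)'` is at least the total flux up to a multiple
of `f`. -/
lemma flux_sub_le_deriv (h : TWProfile m p c A B f y₀) (hm : 1 ≤ m) {y : ℝ} (hy : y < y₀)
    (hf : f y ≤ 1) :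
    flux m c A f y - (|A| + |c|) * f y ≤ deriv (fun x => f x ^ m) y := by
  have hpos := h.pos y hy
  have hv : f y ^ m ≤ f y := by
    simpa using Real.rpow_le_rpow_of_exponent_ge hpos hf hm
  have h1 : A * f y ^ m ≤ |A| * f y :=
    mul_le_mul (le_abs_self A) hv (Real.rpow_nonneg hpos.le m) (abs_nonneg A)
  have h2 : -c * f y ≤ |c| * f y := mul_le_mul_of_nonneg_right (neg_le_abs c) hpos.le
  unfold flux
  linarith

/-- Near the interface, `f ^ (m + p - 1)` is controlled by the flux. -/
lemma rpow_le_flux (h : TWProfile m p c A B f y₀) (hm : 1 ≤ m) (hp : 0 < p) (hB : 0 ≤ B)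
    {a : ℝ} (hf : ∀ y ∈ Ioo a y₀, f y ≤ 1) :
    ∀ y ∈ Ioo a y₀,
      f y ^ (m + p - 1) ≤ (m + p - 1) / m * (|A| + |c|) * flux m c A f y := by
  have hm0 : 0 < m := by linarith
  have hq : 0 < m + p - 1 := by linarith
  set K := (m + p - 1) / m * (|A| + |c|) with hK
  have hK0 : 0 ≤ K := by positivity
  intro y hy
  have key := nonpos_of_deriv_nonneg_of_tendsto_zero (a := a) (b := y₀)
    (g := fun x => f x ^ (m + p - 1) - K * flux m c A f x)
    (fun x hx => (h.hasDerivAt_rpow (m + p - 1) hx.2).sub ((h.hasDerivAt_flux hx.2).const_mul K))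
    (fun x hx => ?_)
    (by simpa using (h.tendsto_rpow_zero hq).sub ((h.tendsto_flux hm0).const_mul K)) y hy
  · linarith
  · have hpos := h.pos x hx.2
    have hle := h.flux_sub_le_deriv hm hx.2 (hf x hx)
    have hflux := h.flux_nonneg hm0 hB hx.2
    rw [(h.hasDerivAt_rpow m hx.2).deriv] at hle
    have hsplit : f x ^ (m + p - 1 - 1) = f x ^ (m - 1) * f x ^ (p - 1) := by
      rw [← Real.rpow_add hpos]
      ring_nf
    have hfp : f x ^ p = f x ^ (p - 1) * f x := by
      rw [← Real.rpow_add_one hpos.ne']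
      ring_nf
    have hweight : 0 ≤ (m + p - 1) / m * f x ^ (p - 1) := by positivity
    have hscaled := mul_le_mul_of_nonneg_left
      (show -((|A| + |c|) * f x) ≤ deriv f x * m * f x ^ (m - 1) by linarith) hweight
    have hlhs : (m + p - 1) / m * f x ^ (p - 1) * -((|A| + |c|) * f x) = -(K * f x ^ p) := by
      rw [hfp, hK]
      ring
    have hrhs : (m + p - 1) / m * f x ^ (p - 1) * (deriv f x * m * f x ^ (m - 1)) =
        deriv f x * (m + p - 1) * f x ^ (m + p - 1 - 1) := by
      rw [hsplit]
      field_simp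
    have hBv : 0 ≤ K * (B * f x ^ m) := by positivity
    linarith

/-- For `m + p < 2` and `B ≥ 0` there is no profile with interface: near the interface the
reaction dominates, forcing `f ^ m` to be nondecreasing. -/
theorem not_of_add_lt_two (hm : 1 ≤ m) (hp : 0 < p) (hmp : m + p < 2) (hB : 0 ≤ B) :
    ¬ TWProfile m p c A B f y₀ := by
  intro h
  have hm0 : 0 < m := by linarith
  set k := |A| + |c| with hk
  set K := (m + p - 1) / m * k with hK
  have hk0 : 0 ≤ k := by positivity
  have hsmall : Tendsto (fun y => k * K * f y ^ (2 - m - p)) (𝓝[<] y₀) (𝓝 0) := by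
    simpa using (h.tendsto_rpow_zero (q := 2 - m - p) (by linarith)).const_mul (k * K)
  obtain ⟨a, ha, hnear⟩ := (mem_nhdsLT_iff_exists_Ioo_subset).1
    ((h.tendsto_zero.eventually_le_const one_pos).and (hsmall.eventually_le_const one_pos))
  have hbound := h.rpow_le_flux hm hp hB (fun y hy => (hnear hy).1)
  obtain ⟨y, hy⟩ := exists_between (show a < y₀ from ha)
  have key := nonpos_of_deriv_nonneg_of_tendsto_zero (a := a) (b := y₀)
    (fun x hx => (h.hasDerivAt_rpow m hx.2).differentiableAt.hasDerivAt) (fun x hx => ?_)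
    (h.tendsto_rpow_zero hm0) y hy
  · exact absurd key (not_le.2 (Real.rpow_pos_of_pos (h.pos y hy.2) m))
  · have hpos := h.pos x hx.2
    have hle := h.flux_sub_le_deriv hm hx.2 (hnear hx).1
    have hflux := h.flux_nonneg hm0 hB hx.2
    have hsplit : f x = f x ^ (2 - m - p) * f x ^ (m + p - 1) := by
      rw [← Real.rpow_add hpos]
      ring_nf
      rw [Real.rpow_one]
    have hkf : k * f x ≤ flux m c A f x := by
      calc k * f x = k * f x ^ (2 - m - p) * f x ^ (m + p - 1) := by
            rw [mul_assoc, ← hsplit]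
        _ ≤ k * f x ^ (2 - m - p) * (K * flux m c A f x) :=
            mul_le_mul_of_nonneg_left (hbound x hx) (by positivity)
        _ = k * K * f x ^ (2 - m - p) * flux m c A f x := by ring
        _ ≤ 1 * flux m c A f x := mul_le_mul_of_nonneg_right (hnear hx).2 hflux
        _ = flux m c A f x := one_mul _
    linarith

end TWProfile

/-- Non-existence of traveling waves for the reaction-convection-diffusion equation
`w_τ = (w^m)_{yy} + A (w^m)_y + B w^m + w^p` when `m + p < 2`. -/
theorem no_traveling_waves_mp_lt_two (m p : ℝ) (N : ℕ)
    (hm : 1 < m) (hp0 : 0 < p) (hp1 : p < 1) (hmp : m + p < 2) (hN : 1 ≤ N) :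
    ∀ c : ℝ, ¬ ∃ (f : ℝ → ℝ) (y₀ : ℝ),
      TWProfile m p c (coefA m N) (coefB m N) f y₀ := by
  rintro c ⟨f, y₀, h⟩
  refine TWProfile.not_of_add_lt_two hm.le hp0 hmp ?_ h
  have hm1 : 0 < m - 1 := by linarith
  unfold coefB
  positivity
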